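/- S₁ > S₂ + S₃. (Lemma 3.4, the finite-sum inequality at the core of the counterexample; numerically S₁ ≈ 42.07, S₂ ≈ 41.04, S₃ ≈ 0.11.) -/

import Mathlib

open Finset

/-- The weights `ω_k = (2k choose k)/4^k`. -/
noncomputable def ω : ℕ → ℝ :=
  fun k => (Nat.choose (2 * k) k : ℝ) / 4 ^ k

/-- Maclaurin coefficients of `F(z) = (1 - √(2/3) z)^(-5/2)`. -/
noncomputable def a : ℕ → ℝ :=
  fun j => ∏ t ∈ Finset.Icc 1 j, (Real.sqrt (2 / 3) * (1 + 3 / (2 * (t : ℝ))))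

noncomputable def S₁ : ℝ :=
  Real.sqrt (2 / 3) * ∑ j ∈ Finset.range 25, (1 + 3 / (2 * ((j : ℝ) + 1))) * (a j) ^ 2 * ω (j + 1)

noncomputable def S₂ : ℝ :=
  ∑ j ∈ Finset.range 25, (a j) ^ 2 * ω (j + 1)

noncomputable def S₃ : ℝ :=
  (5 - Real.sqrt 6) * (a 25) ^ 2 * ω 26

noncomputable def S₄ : ℝ :=
  ∑ j ∈ Finset.range 25, (a j) ^ 2 * ω (j + 1) / ((j : ℝ) + 1)

lemma omega_succ (k : ℕ) : ω (k + 1) = ω k * ((2 * k + 1) / (2 * k + 2)) := by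
  have h := Nat.succ_mul_centralBinom_succ k
  simp only [Nat.centralBinom] at h
  have h' : ((k : ℝ) + 1) * (Nat.choose (2 * (k + 1)) (k + 1) : ℝ)
      = 2 * (2 * k + 1) * (Nat.choose (2 * k) k : ℝ) := by exact_mod_cast h
  have hk : (k : ℝ) + 1 ≠ 0 := by positivity
  have h2 : (Nat.choose (2 * (k + 1)) (k + 1) : ℝ)
      = 2 * (2 * k + 1) * (Nat.choose (2 * k) k : ℝ) / (k + 1) := by
    rw [eq_div_iff hk, ← h']; ring
  have hk2 : 2 * (k : ℝ) + 2 ≠ 0 := by positivity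
  simp only [ω]
  rw [h2, pow_succ]
  field_simp
  ring

lemma a_sq_succ (j : ℕ) :
    a (j + 1) ^ 2 = a j ^ 2 * (2 / 3 * (1 + 3 / (2 * ((j : ℝ) + 1))) ^ 2) := by
  simp only [a]
  rw [Finset.prod_Icc_succ_top (by omega), mul_pow, mul_pow, Real.sq_sqrt (by norm_num)]
  push_cast
  rfl

/-- The rational terms `a_j² ω_{j+1}`. -/
def cc : ℕ → ℚ
  | 0 => 1 / 2
  | j + 1 => cc j * (2 / 3 * (1 + 3 / (2 * ((j : ℚ) + 1))) ^ 2 * ((2 * j + 3) / (2 * j + 4)))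

lemma term_eq (j : ℕ) : a j ^ 2 * ω (j + 1) = (cc j : ℝ) := by
  induction j with
  | zero => norm_num [a, ω, cc]
  | succ j ih =>
    rw [omega_succ (j + 1), a_sq_succ, cc]
    push_cast
    rw [← ih]
    have e1 : 2 * ((j : ℝ) + 1) + 1 = 2 * j + 3 := by ring
    have e2 : 2 * ((j : ℝ) + 1) + 2 = 2 * j + 4 := by ring
    rw [e1, e2]
    ring

lemma rat_ineq : (816496 / 1000000 : ℚ) *
    ∑ j ∈ Finset.range 25, (1 + 3 / (2 * ((j : ℚ) + 1))) * cc j >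
    ∑ j ∈ Finset.range 25, cc j + (5 - 2449 / 1000) * cc 25 := by
  decide +kernel

lemma cc_nonneg (j : ℕ) : 0 ≤ cc j := by
  induction j with
  | zero => norm_num [cc]
  | succ j ih => rw [cc]; positivity

/-- Lemma 3.4: `S₁ > S₂ + S₃`. -/
theorem finite_sum_inequality : S₁ > S₂ + S₃ := by
  have h : (816496 / 1000000 : ℝ) *
      ∑ j ∈ Finset.range 25, (1 + 3 / (2 * ((j : ℝ) + 1))) * (cc j : ℝ) >
      ∑ j ∈ Finset.range 25, (cc j : ℝ) + (5 - 2449 / 1000) * (cc 25 : ℝ) := by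
    have h0 := (Rat.cast_lt (K := ℝ)).mpr rat_ineq
    push_cast at h0
    exact h0
  have hc : ∀ j, (0 : ℝ) ≤ (cc j : ℝ) := fun j => by exact_mod_cast cc_nonneg j
  have s1 : (816496 / 1000000 : ℝ) ≤ Real.sqrt (2 / 3) := Real.le_sqrt_of_sq_le (by norm_num)
  have s2 : (2449 / 1000 : ℝ) ≤ Real.sqrt 6 := Real.le_sqrt_of_sq_le (by norm_num)
  have hs : (0 : ℝ) ≤ ∑ j ∈ Finset.range 25, (1 + 3 / (2 * ((j : ℝ) + 1))) * (cc j : ℝ) :=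
    Finset.sum_nonneg fun j _ => mul_nonneg (by positivity) (hc j)
  have h1 := mul_le_mul_of_nonneg_right s1 hs
  have h2 := mul_le_mul_of_nonneg_right s2 (hc 25)
  have t : a 25 ^ 2 * ω 26 = (cc 25 : ℝ) := term_eq 25
  simp only [S₁, S₂, S₃, mul_assoc, term_eq, t]
  linarith
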